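/- arXiv:2412.09061 — 4 statements merged into one kernel-verified Lean document; each statement's English description precedes it below -/
import Mathlib

section
/- For every ℓ ≤ 0 there exists C > 0, depending only on ℓ and χ₁, such that for all m ≠ 0, all t ≠ 0 and all f ∈ 𝒮(ℝ): sup_{x ∈ ℝ} |(2π)^{−1} ∫_ℝ e^{ixξ} (ξ⁴ + m²)^{ℓ/2} e^{−it√(ξ⁴+m²)} χ₂(ξ⁴) f̂(ξ) dξ| ≤ C |m|^ℓ ⟨m⟩ |t|^{−1/2} ‖f‖_{L¹(ℝ)}. In other words, ‖(Δ² + m²)^{ℓ/2} e^{−it√(Δ²+m²)} χ₂(Δ²)‖_{L¹→L^∞} ≲ |m|^ℓ ⟨m⟩ |t|^{−1/2}. -/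
open MeasureTheory

/-- Integration by parts bound: an amplitude of bounded variation costs at most its final value
plus its total variation. -/
lemma norm_integral_ofReal_mul_le {u : ℝ → ℂ} {A A' : ℝ → ℝ} {a b B : ℝ} (hab : a ≤ b)
    (hu : Continuous u) (hA : ∀ x ∈ Set.Icc a b, HasDerivAt A (A' x) x)
    (hA' : ContinuousOn A' (Set.Icc a b))
    (hB : ∀ s ∈ Set.Icc a b, ‖∫ x in a..s, u x‖ ≤ B) :
    ‖∫ x in a..b, (A x : ℂ) * u x‖ ≤ B * (|A b| + ∫ x in a..b, |A' x|) := by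
  have hAC : ∀ x ∈ Set.uIcc a b, HasDerivAt (fun x => (A x : ℂ)) ((A' x : ℝ) : ℂ) x := by
    intro x hx
    rw [Set.uIcc_of_le hab] at hx
    exact (hA x hx).ofReal_comp
  have hU : ∀ x ∈ Set.uIcc a b, HasDerivAt (fun s => ∫ y in a..s, u y) (u x) x := fun x _ =>
    intervalIntegral.integral_hasDerivAt_right (hu.intervalIntegrable _ _)
      (hu.stronglyMeasurableAtFilter _ _) hu.continuousAt
  have hA'i : IntervalIntegrable A' volume a b :=
    ContinuousOn.intervalIntegrable (by rwa [Set.uIcc_of_le hab])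
  have hbB : ‖∫ x in a..b, u x‖ ≤ B := hB b ⟨hab, le_rfl⟩
  have hrest : ‖∫ x in a..b, ((A' x : ℝ) : ℂ) * ∫ y in a..x, u y‖ ≤
      ∫ x in a..b, B * |A' x| := by
    refine intervalIntegral.norm_integral_le_of_norm_le hab ?_ (hA'i.abs.const_mul B)
    refine Filter.Eventually.of_forall fun x hx => ?_
    rw [norm_mul, Complex.norm_real, Real.norm_eq_abs, mul_comm]
    exact mul_le_mul_of_nonneg_right (hB x ⟨hx.1.le, hx.2⟩) (abs_nonneg _)
  rw [intervalIntegral.integral_mul_deriv_eq_deriv_mul hAC hU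
    (ContinuousOn.intervalIntegrable (by rw [Set.uIcc_of_le hab]; fun_prop)) (hu.intervalIntegrable _ _)]
  simp only [intervalIntegral.integral_same, mul_zero, sub_zero]
  calc _ ≤ ‖(A b : ℂ) * ∫ y in a..b, u y‖
        + ‖∫ x in a..b, ((A' x : ℝ) : ℂ) * ∫ y in a..x, u y‖ := norm_sub_le _ _
    _ ≤ |A b| * B + ∫ x in a..b, B * |A' x| := by
        gcongr
        rw [norm_mul, Complex.norm_real, Real.norm_eq_abs]
        gcongr
    _ = _ := by rw [intervalIntegral.integral_const_mul]; ring

lemma norm_integral_ofReal_mul_le_of_deriv_nonpos {u : ℝ → ℂ} {A A' : ℝ → ℝ} {a b B : ℝ}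
    (hab : a ≤ b) (hu : Continuous u) (hA : ∀ x ∈ Set.Icc a b, HasDerivAt A (A' x) x)
    (hA' : ContinuousOn A' (Set.Icc a b)) (hA'_nonpos : ∀ x ∈ Set.Icc a b, A' x ≤ 0)
    (hAb : 0 ≤ A b) (hB : ∀ s ∈ Set.Icc a b, ‖∫ x in a..s, u x‖ ≤ B) :
    ‖∫ x in a..b, (A x : ℂ) * u x‖ ≤ B * A a := by
  have hvar : ∫ x in a..b, |A' x| = A a - A b := by
    have hcongr : ∫ x in a..b, |A' x| = ∫ x in a..b, -A' x := by
      refine intervalIntegral.integral_congr fun x hx => ?_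
      rw [Set.uIcc_of_le hab] at hx
      exact abs_of_nonpos (hA'_nonpos x hx)
    rw [hcongr, intervalIntegral.integral_neg,
      intervalIntegral.integral_eq_sub_of_hasDerivAt (f := A)
        (by rwa [Set.uIcc_of_le hab])
        (ContinuousOn.intervalIntegrable (by rwa [Set.uIcc_of_le hab]))]
    ring
  have h := norm_integral_ofReal_mul_le hab hu hA hA' hB
  rwa [hvar, abs_of_nonneg hAb, add_sub_cancel] at h

lemma norm_cexp_I_mul_ofReal (r : ℝ) : ‖Complex.exp (Complex.I * (r : ℂ))‖ = 1 := by
  rw [mul_comm, Complex.norm_exp_ofReal_mul_I]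

/-- Van der Corput's first derivative test. -/
lemma norm_integral_cexp_le_of_le_deriv {φ φ' φ'' : ℝ → ℝ} {a b μ : ℝ} (hab : a ≤ b) (hμ : 0 < μ)
    (hφ : ∀ x, HasDerivAt φ (φ' x) x) (hφ' : ∀ x, HasDerivAt φ' (φ'' x) x)
    (hφ'' : Continuous φ'') (hconv : ∀ x ∈ Set.Icc a b, 0 ≤ φ'' x)
    (hlow : ∀ x ∈ Set.Icc a b, μ ≤ φ' x) :
    ‖∫ x in a..b, Complex.exp (Complex.I * (φ x : ℂ))‖ ≤ 2 / μ := by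
  have hφc : Continuous φ := continuous_iff_continuousAt.2 fun x => (hφ x).continuousAt
  have hφ'c : Continuous φ' := continuous_iff_continuousAt.2 fun x => (hφ' x).continuousAt
  have hexp : ∀ x, HasDerivAt (fun x => Complex.exp (Complex.I * (φ x : ℂ)))
      (Complex.exp (Complex.I * (φ x : ℂ)) * (Complex.I * (φ' x : ℂ))) x := fun x =>
    ((hφ x).ofReal_comp.const_mul Complex.I).cexp
  have hcont : Continuous fun x =>
      Complex.exp (Complex.I * (φ x : ℂ)) * (Complex.I * (φ' x : ℂ)) := by fun_prop
  have hpos : ∀ x ∈ Set.Icc a b, 0 < φ' x := fun x hx => hμ.trans_le (hlow x hx)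
  have hB : ∀ s ∈ Set.Icc a b,
      ‖∫ x in a..s, Complex.exp (Complex.I * (φ x : ℂ)) * (Complex.I * (φ' x : ℂ))‖ ≤ 2 := by
    intro s _
    rw [intervalIntegral.integral_eq_sub_of_hasDerivAt (fun x _ => hexp x)
      (hcont.intervalIntegrable _ _)]
    refine (norm_sub_le _ _).trans ?_
    rw [norm_cexp_I_mul_ofReal, norm_cexp_I_mul_ofReal]
    norm_num
  have h := norm_integral_ofReal_mul_le_of_deriv_nonpos (A := fun x => (φ' x)⁻¹)
    (A' := fun x => -φ'' x / φ' x ^ 2) hab hcont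
    (fun x hx => (hφ' x).inv (hpos x hx).ne')
    (ContinuousOn.div (by fun_prop) (by fun_prop) fun x hx => (pow_pos (hpos x hx) 2).ne')
    (fun x hx => div_nonpos_of_nonpos_of_nonneg (neg_nonpos.2 (hconv x hx)) (sq_nonneg _))
    (inv_nonneg.2 (hpos b ⟨hab, le_rfl⟩).le) hB
  have heq : ∫ x in a..b, (((φ' x)⁻¹ : ℝ) : ℂ) *
        (Complex.exp (Complex.I * (φ x : ℂ)) * (Complex.I * (φ' x : ℂ)))
      = (∫ x in a..b, Complex.exp (Complex.I * (φ x : ℂ))) * Complex.I := by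
    rw [← intervalIntegral.integral_mul_const]
    refine intervalIntegral.integral_congr fun x hx => ?_
    rw [Set.uIcc_of_le hab] at hx
    have : (φ' x : ℂ) ≠ 0 := by exact_mod_cast (hpos x hx).ne'
    push_cast
    field_simp
  rw [heq, norm_mul, Complex.norm_I, mul_one] at h
  refine h.trans ?_
  rw [div_eq_mul_inv]
  have := hlow a ⟨le_rfl, hab⟩
  gcongr

lemma norm_integral_cexp_le_sub {φ : ℝ → ℝ} {a b : ℝ} (hab : a ≤ b) :
    ‖∫ x in a..b, Complex.exp (Complex.I * (φ x : ℂ))‖ ≤ b - a := by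
  have h := intervalIntegral.norm_integral_le_of_norm_le_const (a := a) (b := b) (C := 1)
    (f := fun x => Complex.exp (Complex.I * (φ x : ℂ)))
    (fun x _ => (norm_cexp_I_mul_ofReal _).le)
  rwa [one_mul, abs_of_nonneg (sub_nonneg.2 hab)] at h

lemma norm_integral_cexp_le_of_linear_le_deriv {φ φ' φ'' : ℝ → ℝ} {c b μ : ℝ} (hcb : c ≤ b)
    (hμ : 0 < μ) (hφ : ∀ x, HasDerivAt φ (φ' x) x) (hφ' : ∀ x, HasDerivAt φ' (φ'' x) x)
    (hφ'' : Continuous φ'') (hconv : ∀ x ∈ Set.Icc c b, 0 ≤ φ'' x)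
    (hlow : ∀ x ∈ Set.Icc c b, μ * (x - c) ≤ φ' x) :
    ‖∫ x in c..b, Complex.exp (Complex.I * (φ x : ℂ))‖ ≤ 3 / √μ := by
  have hs : 0 < √μ := Real.sqrt_pos.2 hμ
  have hss : √μ * √μ = μ := Real.mul_self_sqrt hμ.le
  have hφc : Continuous φ := continuous_iff_continuousAt.2 fun x => (hφ x).continuousAt
  have hcont : Continuous fun x => Complex.exp (Complex.I * (φ x : ℂ)) := by fun_prop
  rcases le_total b (c + 1 / √μ) with hb | hb
  · refine (norm_integral_cexp_le_sub hcb).trans ?_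
    have : 1 / √μ ≤ 3 / √μ := by gcongr; norm_num
    linarith
  · have hc : c ≤ c + 1 / √μ := by have := one_div_pos.2 hs; linarith
    rw [← intervalIntegral.integral_add_adjacent_intervals
      (hcont.intervalIntegrable c (c + 1 / √μ)) (hcont.intervalIntegrable _ b)]
    have h1 := norm_integral_cexp_le_sub (φ := φ) hc
    have h2 := norm_integral_cexp_le_of_le_deriv hb hs hφ hφ' hφ''
      (fun x hx => hconv x ⟨hc.trans hx.1, hx.2⟩) (fun x hx => by
        refine le_trans ?_ (hlow x ⟨hc.trans hx.1, hx.2⟩)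
        calc √μ = μ * (1 / √μ) := by field_simp; rw [sq, hss]
          _ ≤ μ * (x - c) := by gcongr; linarith [hx.1])
    refine (norm_add_le _ _).trans ((add_le_add h1 h2).trans (le_of_eq ?_))
    ring

lemma norm_integral_cexp_le_of_deriv_le_linear {φ φ' φ'' : ℝ → ℝ} {a c μ : ℝ} (hac : a ≤ c)
    (hμ : 0 < μ) (hφ : ∀ x, HasDerivAt φ (φ' x) x) (hφ' : ∀ x, HasDerivAt φ' (φ'' x) x)
    (hφ'' : Continuous φ'') (hconv : ∀ x ∈ Set.Icc a c, 0 ≤ φ'' x)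
    (hup : ∀ x ∈ Set.Icc a c, φ' x ≤ μ * (x - c)) :
    ‖∫ x in a..c, Complex.exp (Complex.I * (φ x : ℂ))‖ ≤ 3 / √μ := by
  have hmem : ∀ x ∈ Set.Icc (-c) (-a), -x ∈ Set.Icc a c := fun x hx =>
    ⟨by linarith [hx.2], by linarith [hx.1]⟩
  have h := norm_integral_cexp_le_of_linear_le_deriv (φ := fun x => φ (-x))
    (φ' := fun x => -φ' (-x)) (φ'' := fun x => φ'' (-x)) (neg_le_neg hac) hμ
    (fun x => ((hφ (-x)).comp x (hasDerivAt_neg x)).congr_deriv (by ring))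
    (fun x => ((hφ' (-x)).comp x (hasDerivAt_neg x)).neg.congr_deriv (by ring))
    (by fun_prop) (fun x hx => hconv _ (hmem x hx))
    (fun x hx => by have := hup _ (hmem x hx); linarith)
  rw [intervalIntegral.integral_comp_neg
    (fun x => Complex.exp (Complex.I * (φ x : ℂ)))] at h
  simpa using h

/-- Van der Corput's second derivative test. -/
lemma norm_integral_cexp_le_of_le_deriv_deriv {φ φ' φ'' : ℝ → ℝ} {a b μ : ℝ} (hab : a ≤ b)
    (hμ : 0 < μ) (hφ : ∀ x, HasDerivAt φ (φ' x) x) (hφ' : ∀ x, HasDerivAt φ' (φ'' x) x)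
    (hφ'' : Continuous φ'') (hlow : ∀ x ∈ Set.Icc a b, μ ≤ φ'' x) :
    ‖∫ x in a..b, Complex.exp (Complex.I * (φ x : ℂ))‖ ≤ 6 / √μ := by
  have hs : 0 < √μ := Real.sqrt_pos.2 hμ
  have hφc : Continuous φ := continuous_iff_continuousAt.2 fun x => (hφ x).continuousAt
  have hφ'c : Continuous φ' := continuous_iff_continuousAt.2 fun x => (hφ' x).continuousAt
  have hcont : Continuous fun x => Complex.exp (Complex.I * (φ x : ℂ)) := by fun_prop
  have hconv : ∀ x ∈ Set.Icc a b, 0 ≤ φ'' x := fun x hx => hμ.le.trans (hlow x hx)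
  have h36 : 3 / √μ ≤ 6 / √μ := by gcongr; norm_num
  have hmono : MonotoneOn (fun x => φ' x - μ * x) (Set.Icc a b) := by
    have hd : ∀ x, HasDerivAt (fun x => φ' x - μ * x) (φ'' x - μ) x := fun x =>
      ((hφ' x).sub ((hasDerivAt_id x).const_mul μ)).congr_deriv (by ring)
    refine monotoneOn_of_deriv_nonneg (convex_Icc a b) (by fun_prop)
      (fun x _ => (hd x).differentiableAt.differentiableWithinAt) fun x hx => ?_
    rw [(hd x).deriv]
    exact sub_nonneg.2 (hlow x (interior_subset hx))
  rcases le_or_gt 0 (φ' a) with ha | ha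
  · refine (norm_integral_cexp_le_of_linear_le_deriv hab hμ hφ hφ' hφ'' hconv
      fun x hx => ?_).trans h36
    have := hmono ⟨le_rfl, hab⟩ hx hx.1
    dsimp only at this
    linarith
  rcases le_or_gt (φ' b) 0 with hb | hb
  · refine (norm_integral_cexp_le_of_deriv_le_linear hab hμ hφ hφ' hφ'' hconv
      fun x hx => ?_).trans h36
    have := hmono hx ⟨hab, le_rfl⟩ hx.2
    dsimp only at this
    linarith
  obtain ⟨c, hc, hc0⟩ := intermediate_value_Icc hab hφ'c.continuousOn ⟨ha.le, hb.le⟩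
  have h1 := norm_integral_cexp_le_of_deriv_le_linear hc.1 hμ hφ hφ' hφ''
    (fun x hx => hconv x ⟨hx.1, hx.2.trans hc.2⟩) fun x hx => by
      have := hmono ⟨hx.1, hx.2.trans hc.2⟩ hc hx.2
      dsimp only at this
      linarith
  have h2 := norm_integral_cexp_le_of_linear_le_deriv hc.2 hμ hφ hφ' hφ''
    (fun x hx => hconv x ⟨hc.1.trans hx.1, hx.2⟩) fun x hx => by
      have := hmono hc ⟨hc.1.trans hx.1, hx.2⟩ hx.1
      dsimp only at this
      linarith
  rw [← intervalIntegral.integral_add_adjacent_intervals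
    (hcont.intervalIntegrable a c) (hcont.intervalIntegrable c b)]
  refine (norm_add_le _ _).trans ((add_le_add h1 h2).trans (le_of_eq ?_))
  ring

lemma hasDerivAt_pow_four_add_sq (m ξ : ℝ) :
    HasDerivAt (fun ξ : ℝ => ξ ^ 4 + m ^ 2) (4 * ξ ^ 3) ξ := by
  simpa using (hasDerivAt_pow 4 ξ).add_const (m ^ 2)

lemma pow_four_add_sq_pos {m : ℝ} (hm : m ≠ 0) (ξ : ℝ) : 0 < ξ ^ 4 + m ^ 2 := by positivity

lemma hasDerivAt_sqrt_pow_four_add_sq {m : ℝ} (hm : m ≠ 0) (ξ : ℝ) :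
    HasDerivAt (fun ξ : ℝ => √(ξ ^ 4 + m ^ 2)) (2 * ξ ^ 3 / √(ξ ^ 4 + m ^ 2)) ξ := by
  refine ((hasDerivAt_pow_four_add_sq m ξ).sqrt (pow_four_add_sq_pos hm ξ).ne').congr_deriv ?_
  rw [show 4 * ξ ^ 3 = 2 * (2 * ξ ^ 3) by ring, mul_div_mul_left _ _ two_ne_zero]

lemma hasDerivAt_deriv_sqrt_pow_four_add_sq {m : ℝ} (hm : m ≠ 0) (ξ : ℝ) :
    HasDerivAt (fun ξ : ℝ => 2 * ξ ^ 3 / √(ξ ^ 4 + m ^ 2))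
      (2 * ξ ^ 2 * (ξ ^ 4 + 3 * m ^ 2) / √(ξ ^ 4 + m ^ 2) ^ 3) ξ := by
  have hs : 0 < √(ξ ^ 4 + m ^ 2) := Real.sqrt_pos.2 (pow_four_add_sq_pos hm ξ)
  have hss : √(ξ ^ 4 + m ^ 2) ^ 2 = ξ ^ 4 + m ^ 2 := Real.sq_sqrt (pow_four_add_sq_pos hm ξ).le
  refine (((hasDerivAt_pow 3 ξ).const_mul 2).div (hasDerivAt_sqrt_pow_four_add_sq hm ξ)
    hs.ne').congr_deriv ?_
  field_simp
  rw [hss]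
  push_cast
  ring

lemma le_deriv_deriv_sqrt_pow_four_add_sq {m q ξ : ℝ} (hm : m ≠ 0) (hq : 0 < q)
    (hξ : q ≤ ξ ^ 2) :
    q / (1 + q) / (1 + |m|) ≤
      2 * ξ ^ 2 * (ξ ^ 4 + 3 * m ^ 2) / √(ξ ^ 4 + m ^ 2) ^ 3 := by
  have hs : 0 < √(ξ ^ 4 + m ^ 2) := Real.sqrt_pos.2 (pow_four_add_sq_pos hm ξ)
  have hss : √(ξ ^ 4 + m ^ 2) ^ 2 = ξ ^ 4 + m ^ 2 := Real.sq_sqrt (pow_four_add_sq_pos hm ξ).le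
  have hm0 : 0 ≤ |m| := abs_nonneg m
  have hupper : √(ξ ^ 4 + m ^ 2) ≤ ξ ^ 2 + |m| := by
    rw [Real.sqrt_le_left (by positivity)]
    nlinarith [sq_abs m, mul_nonneg (sq_nonneg ξ) hm0]
  calc q / (1 + q) / (1 + |m|) ≤ ξ ^ 2 / (ξ ^ 2 + |m|) := by
        rw [div_div, div_le_div_iff₀ (by positivity) (by positivity)]
        nlinarith [mul_le_mul_of_nonneg_right hξ hm0, mul_nonneg hq.le hm0,
          mul_nonneg (mul_nonneg hq.le hm0) (sq_nonneg ξ), mul_nonneg hq.le (sq_nonneg ξ)]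
    _ ≤ ξ ^ 2 / √(ξ ^ 4 + m ^ 2) := by gcongr
    _ = ξ ^ 2 * √(ξ ^ 4 + m ^ 2) ^ 2 / √(ξ ^ 4 + m ^ 2) ^ 3 := by field_simp
    _ ≤ _ := by
        rw [hss]
        gcongr ?_ / _
        nlinarith [mul_nonneg (sq_nonneg ξ) (sq_nonneg m), mul_nonneg (sq_nonneg ξ)
          (sq_nonneg (ξ ^ 2))]

lemma norm_integral_cexp_add_mul_sqrt_le {m q a b τ : ℝ} (hm : m ≠ 0) (hq : 0 < q)
    (ha : 0 ≤ a) (haq : q ≤ a ^ 2) (hab : a ≤ b) (hτ : 0 < τ) (z : ℝ) :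
    ‖∫ ξ in a..b, Complex.exp (Complex.I * ((z * ξ + τ * √(ξ ^ 4 + m ^ 2) : ℝ) : ℂ))‖ ≤
      6 / √(τ * (q / (1 + q) / (1 + |m|))) := by
  refine norm_integral_cexp_le_of_le_deriv_deriv
    (φ := fun ξ => z * ξ + τ * √(ξ ^ 4 + m ^ 2))
    (φ' := fun ξ => z + τ * (2 * ξ ^ 3 / √(ξ ^ 4 + m ^ 2)))
    (φ'' := fun ξ => τ * (2 * ξ ^ 2 * (ξ ^ 4 + 3 * m ^ 2) / √(ξ ^ 4 + m ^ 2) ^ 3))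
    hab (by positivity) (fun ξ => ?_) (fun ξ => ?_) ?_ fun ξ hξ => ?_
  · exact (((hasDerivAt_id ξ).const_mul z).add
      ((hasDerivAt_sqrt_pow_four_add_sq hm ξ).const_mul τ)).congr_deriv (by ring)
  · exact ((hasDerivAt_deriv_sqrt_pow_four_add_sq hm ξ).const_mul τ).const_add z
  · refine continuous_const.mul (Continuous.div (by fun_prop) (by fun_prop) fun ξ => ?_)
    exact (pow_pos (Real.sqrt_pos.2 (pow_four_add_sq_pos hm ξ)) 3).ne'
  · have : q ≤ ξ ^ 2 := haq.trans (pow_le_pow_left₀ ha hξ.1 2)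
    exact mul_le_mul_of_nonneg_left (le_deriv_deriv_sqrt_pow_four_add_sq hm hq this) hτ.le

lemma norm_integral_cexp_sub_mul_sqrt_le {m q a b t : ℝ} (hm : m ≠ 0) (hq : 0 < q)
    (ha : 0 ≤ a) (haq : q ≤ a ^ 2) (hab : a ≤ b) (ht : t ≠ 0) (z : ℝ) :
    ‖∫ ξ in a..b, Complex.exp (Complex.I * ((z * ξ - t * √(ξ ^ 4 + m ^ 2) : ℝ) : ℂ))‖ ≤
      6 / √(|t| * (q / (1 + q) / (1 + |m|))) := by
  rcases lt_or_gt_of_ne ht with ht | ht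
  · have h := norm_integral_cexp_add_mul_sqrt_le hm hq ha haq hab (neg_pos.2 ht) z
    simpa only [abs_of_neg ht, neg_mul, sub_eq_add_neg] using h
  · have h := norm_integral_cexp_add_mul_sqrt_le hm hq ha haq hab ht (-z)
    have hconj : ∀ ξ : ℝ, Complex.exp (Complex.I * ((z * ξ - t * √(ξ ^ 4 + m ^ 2) : ℝ) : ℂ)) =
        (starRingEnd ℂ)
          (Complex.exp (Complex.I * ((-z * ξ + t * √(ξ ^ 4 + m ^ 2) : ℝ) : ℂ))) := fun ξ => by
      rw [← Complex.exp_conj, map_mul, Complex.conj_I, Complex.conj_ofReal]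
      congr 1
      push_cast
      ring
    simp only [hconj]
    rw [intervalIntegral.integral_of_le hab, integral_conj, RCLike.norm_conj,
      ← intervalIntegral.integral_of_le hab, abs_of_pos ht]
    exact h

lemma rpow_pow_four_add_sq_le {m ℓ : ℝ} (hm : m ≠ 0) (hℓ : ℓ ≤ 0) (ξ : ℝ) :
    (ξ ^ 4 + m ^ 2) ^ (ℓ / 2) ≤ |m| ^ ℓ := by
  have hm2 : 0 < m ^ 2 := by positivity
  calc (ξ ^ 4 + m ^ 2) ^ (ℓ / 2) ≤ (m ^ 2) ^ (ℓ / 2) :=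
        Real.rpow_le_rpow_of_nonpos hm2 (by have : 0 ≤ ξ ^ 4 := by positivity
                                            linarith) (by linarith)
    _ = |m| ^ ℓ := by
        rw [← sq_abs, ← Real.rpow_natCast, ← Real.rpow_mul (abs_nonneg m)]
        congr 1
        push_cast
        ring

/-- The oscillatory integral over a half-line truncation, with the mass weight and a smooth
cutoff `w` of bounded variation. -/
lemma norm_integral_rpow_mul_cutoff_mul_cexp_le {m q a b t ℓ M : ℝ} {w w' : ℝ → ℝ} (hm : m ≠ 0)
    (hq : 0 < q) (ha : 0 ≤ a) (haq : q ≤ a ^ 2) (hab : a ≤ b) (ht : t ≠ 0) (hℓ : ℓ ≤ 0)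
    (hw : ∀ ξ, HasDerivAt w (w' ξ) ξ) (hw' : Continuous w')
    (hM : ∀ s, a ≤ s → |w s| + ∫ ξ in a..s, |w' ξ| ≤ M) (z : ℝ) :
    ‖∫ ξ in a..b, (((ξ ^ 4 + m ^ 2) ^ (ℓ / 2) : ℝ) : ℂ) * ((w ξ : ℂ) *
        Complex.exp (Complex.I * ((z * ξ - t * √(ξ ^ 4 + m ^ 2) : ℝ) : ℂ)))‖ ≤
      6 / √(|t| * (q / (1 + q) / (1 + |m|))) * M * |m| ^ ℓ := by
  have hwc : Continuous w := continuous_iff_continuousAt.2 fun x => (hw x).continuousAt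
  have hM0 : 0 ≤ M := by
    have h := hM a le_rfl
    rw [intervalIntegral.integral_same, add_zero] at h
    exact (abs_nonneg _).trans h
  have hcut : ∀ s ∈ Set.Icc a b, ‖∫ ξ in a..s, (w ξ : ℂ) *
      Complex.exp (Complex.I * ((z * ξ - t * √(ξ ^ 4 + m ^ 2) : ℝ) : ℂ))‖ ≤
      6 / √(|t| * (q / (1 + q) / (1 + |m|))) * M := fun s hs => by
    refine (norm_integral_ofReal_mul_le hs.1 (by fun_prop) (fun ξ _ => hw ξ) hw'.continuousOn
      fun r hr => norm_integral_cexp_sub_mul_sqrt_le hm hq ha haq hr.1 ht z).trans ?_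
    exact mul_le_mul_of_nonneg_left (hM s hs.1) (by positivity)
  refine (norm_integral_ofReal_mul_le_of_deriv_nonpos
    (A := fun ξ => (ξ ^ 4 + m ^ 2) ^ (ℓ / 2))
    (A' := fun ξ => 4 * ξ ^ 3 * (ℓ / 2) * (ξ ^ 4 + m ^ 2) ^ (ℓ / 2 - 1)) hab (by fun_prop)
    (fun ξ _ => (hasDerivAt_pow_four_add_sq m ξ).rpow_const
      (Or.inl (pow_four_add_sq_pos hm ξ).ne')) ?_ (fun ξ hξ => ?_)
    (Real.rpow_nonneg (pow_four_add_sq_pos hm b).le _) hcut).trans ?_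
  · refine Continuous.continuousOn (Continuous.mul (by fun_prop) ?_)
    exact Continuous.rpow_const (by fun_prop) fun ξ => Or.inl (pow_four_add_sq_pos hm ξ).ne'
  · have hξ0 : 0 ≤ ξ := ha.trans hξ.1
    refine mul_nonpos_of_nonpos_of_nonneg (mul_nonpos_of_nonneg_of_nonpos (by positivity)
      (by linarith)) (Real.rpow_nonneg (pow_four_add_sq_pos hm ξ).le _)
  · exact mul_le_mul_of_nonneg_left (rpow_pow_four_add_sq_le hm hℓ a) (by positivity)

/-- The truncated kernel bound, for an even cutoff vanishing near the origin. -/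
lemma norm_integral_symm_rpow_mul_cutoff_mul_cexp_le {m q a b t ℓ M : ℝ} {w w' : ℝ → ℝ}
    (hm : m ≠ 0) (hq : 0 < q) (ha : 0 ≤ a) (haq : q ≤ a ^ 2) (hab : a ≤ b) (ht : t ≠ 0)
    (hℓ : ℓ ≤ 0) (hw : ∀ ξ, HasDerivAt w (w' ξ) ξ) (hw' : Continuous w')
    (hM : ∀ s, a ≤ s → |w s| + ∫ ξ in a..s, |w' ξ| ≤ M) (hweven : ∀ ξ, w (-ξ) = w ξ)
    (hwzero : ∀ ξ ∈ Set.Icc 0 a, w ξ = 0) (z : ℝ) :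
    ‖∫ ξ in (-b)..b, (((ξ ^ 4 + m ^ 2) ^ (ℓ / 2) : ℝ) : ℂ) * ((w ξ : ℂ) *
        Complex.exp (Complex.I * ((z * ξ - t * √(ξ ^ 4 + m ^ 2) : ℝ) : ℂ)))‖ ≤
      2 * (6 / √(|t| * (q / (1 + q) / (1 + |m|))) * M * |m| ^ ℓ) := by
  have hwc : Continuous w := continuous_iff_continuousAt.2 fun x => (hw x).continuousAt
  set G : ℝ → ℝ → ℂ := fun z ξ => (((ξ ^ 4 + m ^ 2) ^ (ℓ / 2) : ℝ) : ℂ) * ((w ξ : ℂ) *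
    Complex.exp (Complex.I * ((z * ξ - t * √(ξ ^ 4 + m ^ 2) : ℝ) : ℂ))) with hG
  have hGc : ∀ z, Continuous (G z) := fun z => by
    refine Continuous.mul (Complex.continuous_ofReal.comp ?_) (by fun_prop)
    exact Continuous.rpow_const (by fun_prop) fun ξ => Or.inl (pow_four_add_sq_pos hm ξ).ne'
  have hhalf : ∀ z, ‖∫ ξ in (0)..b, G z ξ‖ ≤
      6 / √(|t| * (q / (1 + q) / (1 + |m|))) * M * |m| ^ ℓ := fun z => by
    have hzero : ∫ ξ in (0)..a, G z ξ = 0 := by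
      rw [intervalIntegral.integral_congr (g := fun _ => (0 : ℂ)) fun ξ hξ => ?_,
        intervalIntegral.integral_zero]
      rw [Set.uIcc_of_le ha] at hξ
      simp [hG, hwzero ξ hξ]
    rw [← intervalIntegral.integral_add_adjacent_intervals
      ((hGc z).intervalIntegrable 0 a) ((hGc z).intervalIntegrable a b), hzero, zero_add]
    exact norm_integral_rpow_mul_cutoff_mul_cexp_le hm hq ha haq hab ht hℓ hw hw' hM z
  have hreflect : ∫ ξ in (-b)..0, G z ξ = ∫ ξ in (0)..b, G (-z) ξ := by
    have h := intervalIntegral.integral_comp_neg (a := 0) (b := b) (G z)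
    rw [neg_zero] at h
    rw [← h]
    refine intervalIntegral.integral_congr fun ξ _ => ?_
    simp only [hG, hweven, mul_neg, neg_mul, Even.neg_pow (by decide : Even 4)]
  rw [← intervalIntegral.integral_add_adjacent_intervals
    ((hGc z).intervalIntegrable (-b) 0) ((hGc z).intervalIntegrable 0 b), hreflect]
  refine (norm_add_le _ _).trans ((add_le_add (hhalf _) (hhalf _)).trans (le_of_eq ?_))
  ring

/-- A multiplier whose truncated kernels are uniformly bounded by `K` maps `L¹` to `L^∞`
with norm at most `K`. -/
lemma norm_integral_cexp_mul_fourier_le {A θ : ℝ → ℝ} (hA : Continuous A) (hθ : Continuous θ)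
    {f : ℝ → ℂ} (hf : Integrable f) {K a : ℝ} (hK0 : 0 ≤ K)
    (hK : ∀ b, a ≤ b → ∀ z : ℝ,
      ‖∫ ξ in (-b)..b, (A ξ : ℂ) * Complex.exp (Complex.I * ((z * ξ - θ ξ : ℝ) : ℂ))‖ ≤ K)
    (x : ℝ) :
    ‖∫ ξ : ℝ, Complex.exp (Complex.I * ((x * ξ - θ ξ : ℝ) : ℂ)) * (A ξ : ℂ) *
        ∫ y : ℝ, Complex.exp (-(Complex.I * ((y * ξ : ℝ) : ℂ))) * f y‖ ≤ K * ∫ y, ‖f y‖ := by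
  set F : ℝ → ℂ := fun ξ => Complex.exp (Complex.I * ((x * ξ - θ ξ : ℝ) : ℂ)) * (A ξ : ℂ) *
        ∫ y : ℝ, Complex.exp (-(Complex.I * ((y * ξ : ℝ) : ℂ))) * f y with hF
  by_cases hFi : Integrable F
  swap
  · rw [integral_undef hFi, norm_zero]
    exact mul_nonneg hK0 (integral_nonneg fun _ => norm_nonneg _)
  refine le_of_tendsto (intervalIntegral_tendsto_integral hFi Filter.tendsto_neg_atTop_atBot
    Filter.tendsto_id).norm ?_
  filter_upwards [Filter.eventually_ge_atTop a, Filter.eventually_ge_atTop 0] with b hb hb0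
  have hle : -b ≤ b := by linarith
  let H : ℝ → ℝ → ℂ := fun ξ y =>
    Complex.exp (Complex.I * (((x - y) * ξ - θ ξ : ℝ) : ℂ)) * ((A ξ : ℂ) * f y)
  have hFH : ∀ ξ, F ξ = ∫ y, H ξ y := fun ξ => by
    simp only [hF, ← integral_const_mul]
    refine integral_congr_ae (Filter.Eventually.of_forall fun y => ?_)
    have hexp : Complex.exp (Complex.I * (((x - y) * ξ - θ ξ : ℝ) : ℂ)) =
        Complex.exp (Complex.I * ((x * ξ - θ ξ : ℝ) : ℂ)) *
          Complex.exp (-(Complex.I * ((y * ξ : ℝ) : ℂ))) := by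
      rw [← Complex.exp_add]
      congr 1
      push_cast
      ring
    simp only [H, hexp]
    ring
  have hHi : Integrable (Function.uncurry H) ((volume.restrict (Set.Ioc (-b) b)).prod volume) := by
    have hAi : Integrable (fun ξ => (A ξ : ℂ)) (volume.restrict (Set.Ioc (-b) b)) :=
      (Complex.continuous_ofReal.comp hA).integrableOn_Ioc
    refine (hAi.mul_prod hf).bdd_mul (c := 1)
      (f := fun p : ℝ × ℝ => Complex.exp (Complex.I * (((x - p.2) * p.1 - θ p.1 : ℝ) : ℂ))) ?_ ?_
    · exact Continuous.aestronglyMeasurable (by fun_prop)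
    · exact Filter.Eventually.of_forall fun p => (norm_cexp_I_mul_ofReal _).le
  have hswap : ∫ ξ in (-b)..b, F ξ = ∫ y, (∫ ξ in (-b)..b,
      (A ξ : ℂ) * Complex.exp (Complex.I * (((x - y) * ξ - θ ξ : ℝ) : ℂ))) * f y := by
    simp only [hFH]
    rw [intervalIntegral.integral_of_le hle, integral_integral_swap hHi]
    refine integral_congr_ae (Filter.Eventually.of_forall fun y => ?_)
    simp only [H]
    rw [intervalIntegral.integral_of_le hle, ← integral_mul_const]
    refine integral_congr_ae (Filter.Eventually.of_forall fun ξ => ?_)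
    ring
  simp only [id]
  rw [hswap, ← integral_const_mul]
  refine norm_integral_le_of_norm_le (hf.norm.const_mul K)
    (Filter.Eventually.of_forall fun y => ?_)
  rw [norm_mul]
  exact mul_le_mul_of_nonneg_right (hK b hb (x - y)) (norm_nonneg _)

lemma exists_abs_add_integral_abs_deriv_le {χ : ℝ → ℝ} {R a : ℝ} (hχ : ContDiff ℝ (⊤ : ℕ∞) χ)
    (hχc : HasCompactSupport χ) (hχzero : ∀ lam : ℝ, R ≤ |lam| → χ lam = 0) :
    ∃ M > 0, ∀ s, a ≤ s → |1 - χ (s ^ 4)| +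
      ∫ ξ in a..s, |-(deriv χ (ξ ^ 4) * (4 * ξ ^ 3))| ≤ M := by
  have hχ'c : Continuous (deriv χ) := hχ.continuous_deriv (by exact_mod_cast le_top)
  obtain ⟨N, hN⟩ := hχc.exists_bound_of_continuous hχ.continuous
  have hcont : Continuous fun ξ : ℝ => |-(deriv χ (ξ ^ 4) * (4 * ξ ^ 3))| := by fun_prop
  have hsupp : HasCompactSupport fun ξ : ℝ => |-(deriv χ (ξ ^ 4) * (4 * ξ ^ 3))| := by
    refine HasCompactSupport.intro (isCompact_Icc (a := -(1 + |R|)) (b := 1 + |R|)) fun ξ hξ => ?_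
    have habs : 1 + |R| < |ξ| := by
      rw [Set.mem_Icc, ← abs_le] at hξ
      exact not_le.1 hξ
    have hR : R < |ξ ^ 4| := by
      have h1 : 1 ≤ |ξ| := by linarith [abs_nonneg R]
      have h4 : |ξ| ≤ |ξ| ^ 4 := le_self_pow₀ h1 (by norm_num)
      rw [abs_pow]
      linarith [le_abs_self R]
    have hev : χ =ᶠ[nhds (ξ ^ 4)] fun _ => 0 := by
      filter_upwards [(isOpen_lt continuous_const continuous_abs).mem_nhds hR] with y hy
      exact hχzero y (le_of_lt hy)
    simp [hev.deriv_eq]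
  refine ⟨1 + N + (∫ ξ : ℝ, |-(deriv χ (ξ ^ 4) * (4 * ξ ^ 3))|), ?_, fun s hs => ?_⟩
  · have h1 : 0 ≤ N := (norm_nonneg _).trans (hN 0)
    have h2 : 0 ≤ ∫ ξ : ℝ, |-(deriv χ (ξ ^ 4) * (4 * ξ ^ 3))| :=
      integral_nonneg fun _ => abs_nonneg _
    positivity
  · have h1 : |1 - χ (s ^ 4)| ≤ 1 + N := by
      refine (abs_sub _ _).trans ?_
      rw [abs_one]
      have := hN (s ^ 4)
      rw [Real.norm_eq_abs] at this
      linarith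
    refine add_le_add h1 ?_
    rw [intervalIntegral.integral_of_le hs]
    exact setIntegral_le_integral (hcont.integrable_of_hasCompactSupport hsupp)
      (Filter.Eventually.of_forall fun _ => abs_nonneg _)

/-- Free massive estimate, high-energy part (Proposition 2.4):
`‖(Δ²+m²)^{ℓ/2} e^{-it√(Δ²+m²)} χ₂(Δ²)‖_{L¹→L^∞} ≲ |m|^ℓ ⟨m⟩ |t|^{-1/2}`
for `m ≠ 0` and `ℓ ≤ 0`, with `χ₂ = 1 - χ₁` and `⟨m⟩ = 1 + |m|`. -/
theorem stmt_10 (lam₀ : ℝ) (hlam₀ : 0 < lam₀)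
    (χ₁ : ℝ → ℝ) (hχ₁ : ContDiff ℝ (⊤ : ℕ∞) χ₁) (hχ₁c : HasCompactSupport χ₁)
    (hχ₁one : ∀ lam : ℝ, |lam| ≤ lam₀ → χ₁ lam = 1)
    (hχ₁zero : ∀ lam : ℝ, 2 * lam₀ ≤ |lam| → χ₁ lam = 0)
    (ℓ : ℝ) (hℓ : ℓ ≤ 0) :
    ∃ C > 0, ∀ m : ℝ, m ≠ 0 → ∀ t : ℝ, t ≠ 0 → ∀ f : SchwartzMap ℝ ℂ, ∀ x : ℝ,
      ‖(2 * Real.pi)⁻¹ • ∫ ξ : ℝ,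
          Complex.exp (Complex.I * ((x * ξ : ℝ) : ℂ))
          * (((ξ^4 + m^2) ^ (ℓ/2) : ℝ) : ℂ)
          * Complex.exp (-(Complex.I * ((t * Real.sqrt (ξ^4 + m^2) : ℝ) : ℂ)))
          * ((1 - χ₁ (ξ^4) : ℝ) : ℂ)
          * (∫ y : ℝ, Complex.exp (-(Complex.I * ((y * ξ : ℝ) : ℂ))) * f y)‖
      ≤ C * |m| ^ ℓ * (1 + |m|) * |t| ^ (-(1/2) : ℝ) * ∫ y : ℝ, ‖f y‖ := by
  have hq : 0 < √lam₀ := Real.sqrt_pos.2 hlam₀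
  set q := √lam₀ with hq_def
  have haq : √q ^ 2 = q := Real.sq_sqrt hq.le
  have hw : ∀ ξ : ℝ, HasDerivAt (fun ξ : ℝ => 1 - χ₁ (ξ ^ 4))
      (-(deriv χ₁ (ξ ^ 4) * (4 * ξ ^ 3))) ξ := fun ξ => by
    have hd : HasDerivAt χ₁ (deriv χ₁ (ξ ^ 4)) (ξ ^ 4) :=
      (hχ₁.differentiable (by simp) _).hasDerivAt
    have hcomp := HasDerivAt.comp (h := fun ξ : ℝ => ξ ^ 4) ξ hd (hasDerivAt_pow 4 ξ)
    exact (hcomp.const_sub 1).congr_deriv (by push_cast; ring)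
  have hχ'c : Continuous (deriv χ₁) := hχ₁.continuous_deriv (by exact_mod_cast le_top)
  obtain ⟨M, hM0, hM⟩ :=
    exists_abs_add_integral_abs_deriv_le (a := √q) hχ₁ hχ₁c hχ₁zero
  have hwzero : ∀ ξ ∈ Set.Icc 0 √q, 1 - χ₁ (ξ ^ 4) = 0 := fun ξ hξ => by
    have hle : ξ ^ 4 ≤ lam₀ := by
      calc ξ ^ 4 ≤ √q ^ 4 := pow_le_pow_left₀ hξ.1 hξ.2 4
        _ = (√q ^ 2) ^ 2 := by ring
        _ = lam₀ := by rw [haq, hq_def, Real.sq_sqrt hlam₀.le]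
    rw [hχ₁one _ (by rwa [abs_of_nonneg (pow_nonneg hξ.1 4)]), sub_self]
  have hκ : 0 < q / (1 + q) := by positivity
  refine ⟨12 * M / √(q / (1 + q)), by positivity, fun m hm t ht f x => ?_⟩
  have hK0 : 0 ≤ 2 * (6 / √(|t| * (q / (1 + q) / (1 + |m|))) * M * |m| ^ ℓ) := by positivity
  have hmain := norm_integral_cexp_mul_fourier_le
    (A := fun ξ => (ξ ^ 4 + m ^ 2) ^ (ℓ / 2) * (1 - χ₁ (ξ ^ 4)))
    (θ := fun ξ => t * √(ξ ^ 4 + m ^ 2)) (a := √q)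
    (Continuous.mul (Continuous.rpow_const (by fun_prop)
      fun ξ => Or.inl (pow_four_add_sq_pos hm ξ).ne')
      (continuous_const.sub (hχ₁.continuous.comp (continuous_pow 4))))
    (by fun_prop) f.integrable hK0 (fun b hb z => by
      have h := norm_integral_symm_rpow_mul_cutoff_mul_cexp_le hm hq (Real.sqrt_nonneg q)
        haq.ge hb ht hℓ hw (by fun_prop) hM
        (fun ξ => by rw [Even.neg_pow (by decide : Even 4)]) hwzero z
      simpa only [Complex.ofReal_mul, mul_assoc] using h) x
  have hintegrand : ∀ ξ : ℝ, Complex.exp (Complex.I * ((x * ξ : ℝ) : ℂ))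
          * (((ξ^4 + m^2) ^ (ℓ/2) : ℝ) : ℂ)
          * Complex.exp (-(Complex.I * ((t * Real.sqrt (ξ^4 + m^2) : ℝ) : ℂ)))
          * ((1 - χ₁ (ξ^4) : ℝ) : ℂ) =
      Complex.exp (Complex.I * ((x * ξ - t * √(ξ ^ 4 + m ^ 2) : ℝ) : ℂ)) *
        (((ξ ^ 4 + m ^ 2) ^ (ℓ / 2) * (1 - χ₁ (ξ ^ 4)) : ℝ) : ℂ) := fun ξ => by
    rw [Complex.ofReal_sub (x * ξ), mul_sub, sub_eq_add_neg (Complex.I * _), Complex.exp_add, Complex.ofReal_mul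
      ((ξ ^ 4 + m ^ 2) ^ (ℓ / 2))]
    ring
  simp only [hintegrand]
  have hpi : ‖(2 * Real.pi)⁻¹‖ ≤ 1 := by
    rw [Real.norm_of_nonneg (by positivity)]
    exact inv_le_one_of_one_le₀ (by linarith [Real.pi_gt_three])
  rw [norm_smul]
  refine (mul_le_of_le_one_left (norm_nonneg _) hpi).trans (hmain.trans ?_)
  refine mul_le_mul_of_nonneg_right ?_ (integral_nonneg fun _ => norm_nonneg _)
  have hjap : 1 ≤ 1 + |m| := by linarith [abs_nonneg m]
  have hsqrt : √(1 + |m|) ≤ 1 + |m| := Real.sqrt_le_self_iff.2 (Or.inr hjap)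
  have ht' : |t| ^ (-(1/2) : ℝ) = (√|t|)⁻¹ := by
    rw [Real.rpow_neg (abs_nonneg t), ← Real.sqrt_eq_rpow]
  have hts : 0 < √|t| := Real.sqrt_pos.2 (abs_pos.2 ht)
  have hκs : 0 < √(q / (1 + q)) := Real.sqrt_pos.2 hκ
  rw [Real.sqrt_mul (abs_nonneg t), Real.sqrt_div hκ.le, ht']
  calc 2 * (6 / (√|t| * (√(q / (1 + q)) / √(1 + |m|))) * M * |m| ^ ℓ)
      = 12 * M / √(q / (1 + q)) * |m| ^ ℓ * √(1 + |m|) * (√|t|)⁻¹ := by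
        field_simp
        ring
    _ ≤ _ := by gcongr
end

section
/- Let λ > 0 and let F : ℝ → ℂ be twice continuously differentiable with F′(0) = 0. Then for all x, y ∈ ℝ: F(λ|x − y|) = F(λ|x|) − λ y sgn(x) F′(λ|x|) + λ² y² ∫₀¹ (1 − θ) F″(λ|x − θy|) dθ. -/
open MeasureTheory

/-- A function that agrees with `f` on `[0, ∞)` and with `g` on `(-∞, 0]` has derivative `d` at `s`
as soon as each of `f`, `g` does whenever `s` lies in the corresponding half-line. -/
theorem hasDerivAt_of_eqOn_Ici_of_eqOn_Iic {E : Type*} [NormedAddCommGroup E] [NormedSpace ℝ E]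
    {f g h : ℝ → E} {d : E} {s : ℝ} (hf : 0 ≤ s → HasDerivAt f d s)
    (hg : s ≤ 0 → HasDerivAt g d s) (hhf : Set.EqOn h f (Set.Ici 0))
    (hhg : Set.EqOn h g (Set.Iic 0)) : HasDerivAt h d s := by
  rcases lt_trichotomy s 0 with hs | hs | hs
  · exact (hg hs.le).congr_of_eventuallyEq
      (hhg.eventuallyEq_of_mem (Iic_mem_nhds hs))
  · subst hs
    have hR : HasDerivWithinAt h d (Set.Ici 0) 0 :=
      (hf le_rfl).hasDerivWithinAt.congr hhf (hhf Set.self_mem_Ici)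
    have hL : HasDerivWithinAt h d (Set.Iic 0) 0 :=
      (hg le_rfl).hasDerivWithinAt.congr hhg (hhg Set.self_mem_Iic)
    simpa [hasDerivWithinAt_univ] using hL.union hR
  · exact (hf hs.le).congr_of_eventuallyEq
      (hhf.eventuallyEq_of_mem (Ici_mem_nhds hs))

/-- The derivative of `s ↦ F (c * |s|)` when `F' 0 = 0`. -/
theorem hasDerivAt_comp_mul_abs {F F' : ℝ → ℂ} (hF : ∀ t, HasDerivAt F (F' t) t)
    (h0 : F' 0 = 0) (c s : ℝ) :
    HasDerivAt (fun t ↦ F (c * |t|)) (c * (Real.sign s : ℂ) * F' (c * |s|)) s := by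
  refine hasDerivAt_of_eqOn_Ici_of_eqOn_Iic (f := fun t ↦ F (c * t)) (g := fun t ↦ F (-c * t))
    (fun hs ↦ ?_) (fun hs ↦ ?_) (fun t ht ↦ ?_) (fun t ht ↦ ?_)
  · have h := (hF (c * s)).scomp s ((hasDerivAt_id s).const_mul c)
    refine h.congr_deriv ?_
    rcases hs.eq_or_lt with rfl | hs
    · simp [h0]
    · simp [Real.sign_of_pos hs, abs_of_pos hs]
  · have h := (hF (-c * s)).scomp s ((hasDerivAt_id s).const_mul (-c))
    refine h.congr_deriv ?_
    rcases hs.eq_or_lt with rfl | hs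
    · simp [h0]
    · simp [Real.sign_of_neg hs, abs_of_neg hs]
  · simp [abs_of_nonneg (Set.mem_Ici.1 ht)]
  · simp [abs_of_nonpos (Set.mem_Iic.1 ht)]

/-- The derivative of the odd function `s ↦ sgn s * P (c * |s|)` when `P 0 = 0`. -/
theorem hasDerivAt_sign_mul_comp_mul_abs {P P' : ℝ → ℂ} (hP : ∀ t, HasDerivAt P (P' t) t)
    (h0 : P 0 = 0) (c s : ℝ) :
    HasDerivAt (fun t ↦ (Real.sign t : ℂ) * P (c * |t|)) (c * P' (c * |s|)) s := by
  refine hasDerivAt_of_eqOn_Ici_of_eqOn_Iic (f := fun t ↦ P (c * t)) (g := fun t ↦ -P (-c * t))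
    (fun hs ↦ ?_) (fun hs ↦ ?_) (fun t ht ↦ ?_) (fun t ht ↦ ?_)
  · have h := (hP (c * s)).scomp s ((hasDerivAt_id s).const_mul c)
    exact h.congr_deriv (by simp [abs_of_nonneg hs])
  · have h := ((hP (-c * s)).scomp s ((hasDerivAt_id s).const_mul (-c))).neg
    exact h.congr_deriv (by simp [abs_of_nonpos hs])
  · rcases (Set.mem_Ici.1 ht).eq_or_lt with rfl | ht
    · simp [h0]
    · simp [Real.sign_of_pos ht, abs_of_pos ht]
  · rcases (Set.mem_Iic.1 ht).eq_or_lt with rfl | ht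
    · simp [h0]
    · simp [Real.sign_of_neg ht, abs_of_neg ht]

/-- Taylor-type expansion lemma (Lemma 3.5 (ii)): for `λ > 0` and `F ∈ C²(ℝ, ℂ)`
with `F′(0) = 0`,
`F(λ|x−y|) = F(λ|x|) − λy sgn(x) F′(λ|x|) + λ²y² ∫₀¹ (1−θ) F″(λ|x−θy|) dθ`. -/
theorem stmt_14 (lam : ℝ) (hlam : 0 < lam) (F : ℝ → ℂ) (hF : ContDiff ℝ 2 F)
    (hF0 : deriv F 0 = 0) (x y : ℝ) :
    F (lam * |x - y|) = F (lam * |x|)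
      - ((lam * y : ℝ) : ℂ) * ((Real.sign x : ℝ) : ℂ) * deriv F (lam * |x|)
      + ((lam^2 * y^2 : ℝ) : ℂ) * ∫ θ in (0:ℝ)..1,
          ((1 - θ : ℝ) : ℂ) * iteratedDeriv 2 F (lam * |x - θ * y|) := by
  have hF' : ∀ t, HasDerivAt F (deriv F t) t := fun t ↦
    (hF.differentiable (by norm_num)).differentiableAt.hasDerivAt
  have hF'' : ∀ t, HasDerivAt (deriv F) (iteratedDeriv 2 F t) t := fun t ↦ by
    have h := (hF.differentiable_iteratedDeriv 1 (by norm_num)) t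
    rw [iteratedDeriv_succ, iteratedDeriv_one]
    rw [iteratedDeriv_one] at h
    exact h.hasDerivAt
  have hcont : Continuous (iteratedDeriv 2 F) := hF.continuous_iteratedDeriv 2 le_rfl
  have hΦ : ∀ θ : ℝ, HasDerivAt (fun θ : ℝ ↦ F (lam * |x - θ * y|)
      - ((1 - θ : ℝ) : ℂ) * ((lam * y : ℝ) : ℂ)
        * ((Real.sign (x - θ * y) : ℂ) * deriv F (lam * |x - θ * y|)))
      (((lam^2 * y^2 : ℝ) : ℂ) *
        (((1 - θ : ℝ) : ℂ) * iteratedDeriv 2 F (lam * |x - θ * y|))) θ := fun θ ↦ by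
    have hin : HasDerivAt (fun θ : ℝ ↦ x - θ * y) (-y) θ := by
      simpa using ((hasDerivAt_id θ).mul_const y).const_sub x
    have h1 := (hasDerivAt_comp_mul_abs hF' hF0 lam (x - θ * y)).scomp θ hin
    have h2 := (hasDerivAt_sign_mul_comp_mul_abs hF'' hF0 lam (x - θ * y)).scomp θ hin
    have h3 : HasDerivAt (fun θ : ℝ ↦ ((1 - θ : ℝ) : ℂ) * ((lam * y : ℝ) : ℂ))
        (-((lam * y : ℝ) : ℂ)) θ := by
      simpa using (((hasDerivAt_id θ).const_sub 1).ofReal_comp).mul_const ((lam * y : ℝ) : ℂ)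
    refine (h1.sub (h3.mul h2)).congr_deriv ?_
    simp only [Function.comp_apply, Complex.real_smul]
    push_cast
    ring
  have hFTC := intervalIntegral.integral_eq_sub_of_hasDerivAt (a := 0) (b := 1)
    (fun θ _ ↦ hΦ θ) (Continuous.intervalIntegrable (by fun_prop) _ _)
  rw [intervalIntegral.integral_const_mul] at hFTC
  rw [hFTC]
  simp only [sub_self, Complex.ofReal_zero, zero_mul, one_mul, sub_zero, Complex.ofReal_one]
  ring
end

section
/- Let λ > 0 and let F : ℝ → ℂ be three times continuously differentiable with F′(0) = F″(0) = 0. Then for all x, y ∈ ℝ: F(λ|x − y|) = F(λ|x|) − λ y sgn(x) F′(λ|x|) + (λ² y²/2) F″(λ|x|) − (λ³ y³/2) ∫₀¹ (1 − θ)² (sgn(x − θy))³ F⁽³⁾(λ|x − θy|) dθ. -/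
open MeasureTheory

lemma Real.measurable_sign : Measurable Real.sign :=
  Measurable.ite measurableSet_Iio measurable_const
    (Measurable.ite measurableSet_Ioi measurable_const measurable_const)

lemma Real.sign_sq_of_ne_zero {t : ℝ} (ht : t ≠ 0) : ((Real.sign t : ℝ) : ℂ) ^ 2 = 1 := by
  rcases Real.sign_apply_eq_of_ne_zero t ht with h | h <;> simp [h]

lemma Real.norm_sign_le_one (t : ℝ) : ‖((Real.sign t : ℝ) : ℂ)‖ ≤ 1 := by
  rcases Real.sign_apply_eq t with h | h | h <;> simp [h]

/-- Away from `0`, the sign function is locally constant. -/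
lemma Real.hasDerivAt_ofReal_sign {t : ℝ} (ht : t ≠ 0) :
    HasDerivAt (fun s : ℝ ↦ ((Real.sign s : ℝ) : ℂ)) 0 t := by
  refine (hasDerivAt_const t ((Real.sign t : ℝ) : ℂ)).congr_of_eventuallyEq ?_
  rcases lt_or_gt_of_ne ht with h | h
  · filter_upwards [Iio_mem_nhds h] with s hs
    rw [Real.sign_of_neg hs, Real.sign_of_neg h]
  · filter_upwards [Ioi_mem_nhds h] with s hs
    rw [Real.sign_of_pos hs, Real.sign_of_pos h]

lemma Real.hasDerivAt_abs_sign {t : ℝ} (ht : t ≠ 0) : HasDerivAt (fun s ↦ |s|) (Real.sign t) t := by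
  rcases lt_or_gt_of_ne ht with h | h
  · simpa [Real.sign_of_neg h] using hasDerivAt_abs_neg h
  · simpa [Real.sign_of_pos h] using hasDerivAt_abs_pos h

/-- The odd extension of a continuous function vanishing at `0` is continuous. -/
lemma continuous_sign_mul_comp_abs {G : ℝ → ℂ} (hG : Continuous G) (hG0 : G 0 = 0) (lam : ℝ) :
    Continuous fun t : ℝ ↦ ((Real.sign t : ℝ) : ℂ) * G (lam * |t|) := by
  have hc : Continuous fun t : ℝ ↦ G (lam * |t|) := by fun_prop
  rw [continuous_iff_continuousAt]
  intro t
  rcases eq_or_ne t 0 with rfl | ht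
  · rw [ContinuousAt]
    simp only [Real.sign_zero, Complex.ofReal_zero, zero_mul]
    refine squeeze_zero_norm (a := fun t : ℝ ↦ ‖G (lam * |t|)‖) (fun s ↦ ?_) ?_
    · rw [norm_mul]
      exact mul_le_of_le_one_left (norm_nonneg _) (Real.norm_sign_le_one s)
    · simpa [hG0] using hc.norm.tendsto 0
  · exact (Real.hasDerivAt_ofReal_sign ht).continuousAt.mul hc.continuousAt

lemma hasDerivAt_comp_mul_abs_sub {G G' : ℝ → ℂ} (hG : ∀ s, HasDerivAt G (G' s) s)
    (lam x y : ℝ) {θ : ℝ} (hθ : x - θ * y ≠ 0) :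
    HasDerivAt (fun θ : ℝ ↦ G (lam * |x - θ * y|))
      (-((lam * y : ℝ) : ℂ) * ((Real.sign (x - θ * y) : ℝ) : ℂ) * G' (lam * |x - θ * y|)) θ := by
  have h1 : HasDerivAt (fun θ : ℝ ↦ x - θ * y) (-y) θ := by
    simpa using ((hasDerivAt_id θ).mul_const y).const_sub x
  have h2 : HasDerivAt (fun θ : ℝ ↦ lam * |x - θ * y|)
      (lam * (Real.sign (x - θ * y) * -y)) θ :=
    (HasDerivAt.comp θ (h₂ := fun s : ℝ ↦ |s|) (Real.hasDerivAt_abs_sign hθ) h1).const_mul lam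
  refine ((hG _).scomp θ h2).congr_deriv ?_
  rw [Complex.real_smul]
  push_cast
  ring

/-- Taylor-type expansion lemma (Lemma 3.5 (iii)): for `λ > 0` and `F ∈ C³(ℝ, ℂ)`
with `F′(0) = F″(0) = 0`,
`F(λ|x−y|) = F(λ|x|) − λy sgn(x) F′(λ|x|) + (λ²y²/2) F″(λ|x|)
  − (λ³y³/2) ∫₀¹ (1−θ)² (sgn(x−θy))³ F⁽³⁾(λ|x−θy|) dθ`. -/
theorem stmt_15 (lam : ℝ) (hlam : 0 < lam) (F : ℝ → ℂ) (hF : ContDiff ℝ 3 F)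
    (hF0 : deriv F 0 = 0) (hF0' : iteratedDeriv 2 F 0 = 0) (x y : ℝ) :
    F (lam * |x - y|) = F (lam * |x|)
      - ((lam * y : ℝ) : ℂ) * ((Real.sign x : ℝ) : ℂ) * deriv F (lam * |x|)
      + ((lam^2 * y^2 / 2 : ℝ) : ℂ) * iteratedDeriv 2 F (lam * |x|)
      - ((lam^3 * y^3 / 2 : ℝ) : ℂ) * ∫ θ in (0:ℝ)..1,
          ((1 - θ : ℝ) : ℂ)^2 * ((Real.sign (x - θ * y) : ℝ) : ℂ)^3
          * iteratedDeriv 3 F (lam * |x - θ * y|) := by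
  rcases eq_or_ne y 0 with rfl | hy
  · simp
  have d0 : ∀ s, HasDerivAt F (deriv F s) s := fun s ↦
    (hF.differentiable (by norm_num) s).hasDerivAt
  have d1 : ∀ s, HasDerivAt (deriv F) (iteratedDeriv 2 F s) s := fun s ↦ by
    have := (hF.differentiable_iteratedDeriv 1 (by norm_num) s).hasDerivAt
    rwa [← iteratedDeriv_succ, iteratedDeriv_one] at this
  have d2 : ∀ s, HasDerivAt (iteratedDeriv 2 F) (iteratedDeriv 3 F s) s := fun s ↦ by
    have := (hF.differentiable_iteratedDeriv 2 (by norm_cast) s).hasDerivAt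
    rwa [← iteratedDeriv_succ] at this
  have c0 : Continuous F := hF.continuous
  have c1 : Continuous (deriv F) := continuous_iff_continuousAt.2 fun s ↦ (d1 s).continuousAt
  have c2 : Continuous (iteratedDeriv 2 F) :=
    continuous_iff_continuousAt.2 fun s ↦ (d2 s).continuousAt
  have c3 : Continuous (iteratedDeriv 3 F) := hF.continuous_iteratedDeriv 3 le_rfl
  have hint : IntervalIntegrable (fun θ : ℝ ↦
      ((1 - θ : ℝ) : ℂ)^2 * ((Real.sign (x - θ * y) : ℝ) : ℂ)^3
        * iteratedDeriv 3 F (lam * |x - θ * y|)) volume 0 1 := by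
    have hb : Continuous fun θ : ℝ ↦
        ((1 - θ : ℝ) : ℂ)^2 * iteratedDeriv 3 F (lam * |x - θ * y|) := by fun_prop
    refine (hb.intervalIntegrable 0 1).mono_fun (Measurable.aestronglyMeasurable ?_)
      (Filter.Eventually.of_forall fun θ ↦ ?_)
    · have hs : Measurable fun θ : ℝ ↦ ((Real.sign (x - θ * y) : ℝ) : ℂ) :=
        Complex.measurable_ofReal.comp (Real.measurable_sign.comp (by fun_prop))
      have h3 : Measurable fun θ : ℝ ↦ iteratedDeriv 3 F (lam * |x - θ * y|) :=
        Continuous.measurable (by fun_prop)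
      exact (Measurable.mul (by fun_prop) (hs.pow_const 3)).mul h3
    · simp only [norm_mul, norm_pow]
      gcongr
      exact mul_le_of_le_one_right (by positivity)
        (pow_le_one₀ (norm_nonneg _) (Real.norm_sign_le_one _))
  set H : ℝ → ℂ := fun θ ↦ F (lam * |x - θ * y|)
    - ((lam * y : ℝ) : ℂ) * ((1 - θ : ℝ) : ℂ)
      * (((Real.sign (x - θ * y) : ℝ) : ℂ) * deriv F (lam * |x - θ * y|))
    + ((lam^2 * y^2 / 2 : ℝ) : ℂ) * ((1 - θ : ℝ) : ℂ)^2
      * iteratedDeriv 2 F (lam * |x - θ * y|) with hH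
  have hHc : Continuous H := by
    have hs : Continuous fun θ : ℝ ↦
        ((Real.sign (x - θ * y) : ℝ) : ℂ) * deriv F (lam * |x - θ * y|) :=
      (continuous_sign_mul_comp_abs c1 hF0 lam).comp (by fun_prop : Continuous fun θ ↦ x - θ * y)
    exact ((by fun_prop : Continuous fun θ : ℝ ↦ F (lam * |x - θ * y|)).sub
      (Continuous.mul (by fun_prop) hs)).add (by fun_prop)
  have hHd : ∀ θ, x - θ * y ≠ 0 → HasDerivAt H (-((lam^3 * y^3 / 2 : ℝ) : ℂ) *
      (((1 - θ : ℝ) : ℂ)^2 * ((Real.sign (x - θ * y) : ℝ) : ℂ)^3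
        * iteratedDeriv 3 F (lam * |x - θ * y|))) θ := by
    intro θ hθ
    have hl : HasDerivAt (fun θ : ℝ ↦ ((1 - θ : ℝ) : ℂ)) (-1) θ := by
      simpa using ((hasDerivAt_id θ).const_sub 1).ofReal_comp
    have hs : HasDerivAt (fun θ : ℝ ↦ ((Real.sign (x - θ * y) : ℝ) : ℂ)) 0 θ := by
      have h1 : HasDerivAt (fun θ : ℝ ↦ x - θ * y) (-y) θ := by
        simpa using ((hasDerivAt_id θ).mul_const y).const_sub x
      simpa [Function.comp_def] using (Real.hasDerivAt_ofReal_sign hθ).scomp θ h1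
    have key := ((hasDerivAt_comp_mul_abs_sub d0 lam x y hθ).sub
      ((hl.const_mul ((lam * y : ℝ) : ℂ)).mul
        (hs.mul (hasDerivAt_comp_mul_abs_sub d1 lam x y hθ)))).add
      (((hl.pow 2).const_mul ((lam^2 * y^2 / 2 : ℝ) : ℂ)).mul
        (hasDerivAt_comp_mul_abs_sub d2 lam x y hθ))
    refine key.congr_deriv ?_
    simp only [Pi.pow_apply, Pi.mul_apply]
    have hsq := Real.sign_sq_of_ne_zero hθ
    generalize ((Real.sign (x - θ * y) : ℝ) : ℂ) = σ at hsq ⊢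
    push_cast
    have h3 : σ ^ 3 = σ := by rw [pow_succ, hsq, one_mul]
    rw [h3]
    linear_combination (lam ^ 2 * y ^ 2 * (1 - θ) * iteratedDeriv 2 F (lam * |x - θ * y|)) * hsq
  have hfin := integral_eq_of_hasDerivAt_off_countable H _ (Set.countable_singleton (x / y))
    hHc.continuousOn (fun θ hθ ↦ hHd θ fun h ↦ hθ.2 (by
      rw [Set.mem_singleton_iff, eq_div_iff hy]; linarith)) (hint.const_mul _)
  rw [intervalIntegral.integral_const_mul] at hfin
  simp only [hH, one_mul, zero_mul, sub_zero, sub_self, Complex.ofReal_zero,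
    Complex.ofReal_one] at hfin
  linear_combination -hfin
end

section
/- Let α ∈ {1, 2, 3}, λ > 0, and let g : ℝ → ℂ be measurable with ∫_ℝ ⟨y⟩^α |g(y)| dy < ∞ and ∫_ℝ y^k g(y) dy = 0 for every integer k with 0 ≤ k ≤ α − 1. Then for every x ∈ ℝ: ∫_ℝ R₀^±(λ⁴)(x, y) g(y) dy = ((−1)^α λ^{α−3} / (4 (α−1)!)) ∫_ℝ ∫₀¹ (1 − θ)^{α−1} (sgn(x − θy))^α F_±^{(α)}(λ|x − θy|) y^α g(y) dθ dy, where F_±^{(α)} denotes the α-th derivative of F_±. -/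
open MeasureTheory

/-- `F₊(s) = i e^{is} − e^{−s}` (for `ε = 1`) and `F₋(s) = −i e^{−is} − e^{−s}`
(for `ε = -1`). -/
noncomputable def Fpm (ε : ℝ) (s : ℝ) : ℂ :=
  (ε : ℂ) * Complex.I * Complex.exp ((ε : ℂ) * Complex.I * (s : ℂ))
    - Complex.exp (-(s : ℂ))

/-- The `k`-th derivative of `Fpm ε`, in closed form. -/
noncomputable def FpmDeriv (ε : ℝ) (k : ℕ) (s : ℝ) : ℂ :=
  ((ε : ℂ) * Complex.I) ^ (k + 1) * Complex.exp ((ε : ℂ) * Complex.I * (s : ℂ))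
    - (-1) ^ k * Complex.exp (-(s : ℂ))

lemma hasDerivAt_FpmDeriv (ε : ℝ) (k : ℕ) (s : ℝ) :
    HasDerivAt (FpmDeriv ε k) (FpmDeriv ε (k + 1) s) s := by
  have hs : HasDerivAt (fun t : ℝ => (t : ℂ)) 1 s := Complex.ofRealCLM.hasDerivAt
  have h1 := ((hs.const_mul ((ε : ℂ) * Complex.I)).cexp).const_mul
    (((ε : ℂ) * Complex.I) ^ (k + 1))
  have h2 := (hs.neg.cexp).const_mul ((-1 : ℂ) ^ k)
  refine (h1.sub h2).congr_deriv ?_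
  simp only [FpmDeriv, Pi.neg_apply]
  ring

lemma iteratedDeriv_Fpm (ε : ℝ) (k : ℕ) : iteratedDeriv k (Fpm ε) = FpmDeriv ε k := by
  induction k with
  | zero => ext s; simp [FpmDeriv, Fpm]
  | succ k ih =>
    rw [iteratedDeriv_succ, ih]
    ext s
    exact (hasDerivAt_FpmDeriv ε k s).deriv

lemma continuous_FpmDeriv (ε : ℝ) (k : ℕ) : Continuous (FpmDeriv ε k) :=
  continuous_iff_continuousAt.2 fun s => (hasDerivAt_FpmDeriv ε k s).continuousAt

lemma norm_FpmDeriv_le {ε : ℝ} (hε : ε = 1 ∨ ε = -1) (k : ℕ) {s : ℝ} (hs : 0 ≤ s) :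
    ‖FpmDeriv ε k s‖ ≤ 2 := by
  have hn : ‖(ε : ℂ)‖ = 1 := by rcases hε with rfl | rfl <;> simp
  have h1 : ‖Complex.exp ((ε : ℂ) * Complex.I * (s : ℂ))‖ = 1 := by
    rw [Complex.norm_exp]; simp
  have h2 : ‖Complex.exp (-(s : ℂ))‖ ≤ 1 := by
    rw [Complex.norm_exp]; simpa using hs
  refine (norm_sub_le _ _).trans ?_
  simp only [norm_mul, norm_pow, hn, h1, Complex.norm_I, norm_neg, norm_one, one_pow, one_mul]
  linarith

/-- The `k`-th derivative, divided by `lam ^ k`, of `u ↦ Fpm ε (lam * |u|)` away from `u = 0`. -/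
noncomputable def FpmAbsDeriv (ε lam : ℝ) (k : ℕ) (u : ℝ) : ℂ :=
  if u ≤ 0 then (-1) ^ k * FpmDeriv ε k (lam * -u) else FpmDeriv ε k (lam * u)

lemma continuous_FpmAbsDeriv {ε : ℝ} (hε : ε = 1 ∨ ε = -1) (lam : ℝ) {k : ℕ} (hk : k < 3) :
    Continuous (FpmAbsDeriv ε lam k) := by
  have hc := continuous_FpmDeriv ε k
  refine Continuous.if_le (by fun_prop) (by fun_prop) continuous_id continuous_const ?_
  rintro u rfl
  have hε2 : (ε : ℂ) ^ 2 = 1 := by rcases hε with rfl | rfl <;> simp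
  interval_cases k <;> simp [FpmDeriv, mul_pow, hε2]

lemma hasDerivAt_FpmAbsDeriv (ε lam : ℝ) (k : ℕ) {u : ℝ} (hu : u ≠ 0) :
    HasDerivAt (FpmAbsDeriv ε lam k) (lam * FpmAbsDeriv ε lam (k + 1) u) u := by
  rcases hu.lt_or_gt with h | h
  · have hd := ((hasDerivAt_FpmDeriv ε k (lam * -u)).scomp u
      ((hasDerivAt_neg u).const_mul lam)).const_mul ((-1 : ℂ) ^ k)
    have heq : FpmAbsDeriv ε lam k =ᶠ[nhds u]
        fun v => (-1) ^ k * (FpmDeriv ε k ∘ fun v => lam * -v) v := by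
      filter_upwards [Iio_mem_nhds h] with v hv
      simp [FpmAbsDeriv, (Set.mem_Iio.1 hv).le]
    refine (hd.congr_of_eventuallyEq heq).congr_deriv ?_
    simp only [FpmAbsDeriv, h.le, if_true, Complex.real_smul]
    push_cast
    ring
  · have hd := (hasDerivAt_FpmDeriv ε k (lam * u)).scomp u
      ((hasDerivAt_id u).const_mul lam)
    have heq : FpmAbsDeriv ε lam k =ᶠ[nhds u] FpmDeriv ε k ∘ fun v => lam * id v := by
      filter_upwards [Ioi_mem_nhds h] with v hv
      simp [FpmAbsDeriv, not_le.2 (Set.mem_Ioi.1 hv)]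
    refine (hd.congr_of_eventuallyEq heq).congr_deriv ?_
    simp [FpmAbsDeriv, not_le.2 h]

lemma FpmAbsDeriv_eq_sign_pow_mul (ε lam : ℝ) (k : ℕ) {u : ℝ} (hu : u ≠ 0) :
    FpmAbsDeriv ε lam k u = ((Real.sign u : ℝ) : ℂ) ^ k * FpmDeriv ε k (lam * |u|) := by
  rcases hu.lt_or_gt with h | h
  · simp [FpmAbsDeriv, h.le, Real.sign_of_neg h, abs_of_neg h]
  · simp [FpmAbsDeriv, not_le.2 h, Real.sign_of_pos h, abs_of_pos h]

lemma FpmAbsDeriv_zero (ε lam u : ℝ) : FpmAbsDeriv ε lam 0 u = Fpm ε (lam * |u|) := by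
  rcases le_or_gt u 0 with h | h
  · simp [FpmAbsDeriv, h, abs_of_nonpos h, FpmDeriv, Fpm]
  · simp [FpmAbsDeriv, not_le.2 h, abs_of_pos h, FpmDeriv, Fpm]

/-- The derivative in the base point of a Taylor polynomial evaluated at `1`. -/
lemma hasDerivAt_taylor_sum (h : ℕ → ℝ → ℂ) (θ : ℝ)
    (hh : ∀ k, HasDerivAt (h k) (h (k + 1) θ) θ) (n : ℕ) :
    HasDerivAt
      (fun t : ℝ => ∑ k ∈ Finset.range (n + 1), ((1 - t : ℝ) : ℂ) ^ k / (k.factorial : ℂ) * h k t)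
      (((1 - θ : ℝ) : ℂ) ^ n / (n.factorial : ℂ) * h (n + 1) θ) θ := by
  induction n with
  | zero => simpa using hh 0
  | succ n ih =>
    have hs : HasDerivAt (fun t : ℝ => ((1 - t : ℝ) : ℂ)) ((-1 : ℝ) : ℂ) θ :=
      ((hasDerivAt_id θ).const_sub 1).ofReal_comp
    have h1 := ((hs.pow (n + 1)).div_const ((n + 1).factorial : ℂ)).mul (hh (n + 1))
    simp_rw [Finset.sum_range_succ _ (n + 1)]
    refine (ih.add h1).congr_deriv ?_
    have hf : (n.factorial : ℂ) ≠ 0 := by exact_mod_cast n.factorial_ne_zero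
    have hn : (n : ℂ) + 1 ≠ 0 := by exact_mod_cast n.succ_ne_zero
    simp only [Nat.factorial_succ, Pi.pow_apply, Nat.add_sub_cancel]
    push_cast
    field_simp
    ring

/-- The kernel appearing in the integral remainder is integrable in `θ`. -/
lemma intervalIntegrable_remainder (ε lam : ℝ) (n k : ℕ) (x y : ℝ) :
    IntervalIntegrable (fun θ : ℝ => ((1 - θ : ℝ) : ℂ) ^ n *
      ((Real.sign (x - θ * y) : ℝ) : ℂ) ^ k * FpmDeriv ε k (lam * |x - θ * y|))
      volume 0 1 := by
  have hc : Continuous fun θ : ℝ => ((1 - θ : ℝ) : ℂ) ^ n := by fun_prop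
  have hF : Continuous fun θ : ℝ => FpmDeriv ε k (lam * |x - θ * y|) :=
    (continuous_FpmDeriv ε k).comp (by fun_prop)
  have hsm : Measurable Real.sign :=
    Measurable.ite measurableSet_Iio measurable_const
      (Measurable.ite measurableSet_Ioi measurable_const measurable_const)
  have hs : Measurable fun θ : ℝ => ((Real.sign (x - θ * y) : ℝ) : ℂ) ^ k :=
    (Complex.measurable_ofReal.comp (hsm.comp (by fun_prop))).pow_const k
  have hi := ((hc.mul hF).intervalIntegrable (μ := volume) 0 1)
  rw [intervalIntegrable_iff] at hi ⊢
  refine Integrable.mono hi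
    ((hc.measurable.mul hs).mul hF.measurable).aestronglyMeasurable
    (Filter.Eventually.of_forall fun θ => ?_)
  have hle : ‖((Real.sign (x - θ * y) : ℝ) : ℂ) ^ k‖ ≤ 1 := by
    rw [norm_pow]
    refine pow_le_one₀ (norm_nonneg _) ?_
    rcases Real.sign_apply_eq (x - θ * y) with h | h | h <;> simp [h]
  simp only [Pi.mul_apply, norm_mul]
  exact mul_le_mul_of_nonneg_right (mul_le_of_le_one_right (norm_nonneg _) hle) (norm_nonneg _)

/-- Taylor's formula with integral remainder for `u ↦ Fpm ε (lam * |u|)`. -/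
lemma integral_remainder {ε : ℝ} (hε : ε = 1 ∨ ε = -1) (lam : ℝ)
    {n : ℕ} (hn : n < 3) (x y : ℝ) :
    (-(lam : ℂ) * y) ^ (n + 1) / (n.factorial : ℂ) *
      ∫ θ in (0:ℝ)..1, ((1 - θ : ℝ) : ℂ) ^ n *
        ((Real.sign (x - θ * y) : ℝ) : ℂ) ^ (n + 1) * FpmDeriv ε (n + 1) (lam * |x - θ * y|)
    = Fpm ε (lam * |x - y|) - ∑ k ∈ Finset.range (n + 1),
        (-(lam : ℂ) * y) ^ k / (k.factorial : ℂ) * FpmAbsDeriv ε lam k x := by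
  rcases eq_or_ne y 0 with rfl | hy
  · simp [Finset.sum_range_succ', FpmAbsDeriv_zero]
  set h : ℕ → ℝ → ℂ := fun k t => (-(lam : ℂ) * y) ^ k * FpmAbsDeriv ε lam k (x - t * y) with hdef
  have hderiv : ∀ θ : ℝ, x - θ * y ≠ 0 → ∀ k, HasDerivAt (h k) (h (k + 1) θ) θ := by
    intro θ hθ k
    have hd := ((hasDerivAt_FpmAbsDeriv ε lam k hθ).scomp θ
      (((hasDerivAt_id θ).mul_const y).const_sub x)).const_mul ((-(lam : ℂ) * y) ^ k)
    refine hd.congr_deriv ?_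
    simp only [hdef, Complex.real_smul]
    push_cast
    ring
  rw [← intervalIntegral.integral_const_mul]
  have key := integral_eq_of_hasDerivAt_off_countable
    (fun t : ℝ => ∑ k ∈ Finset.range (n + 1), ((1 - t : ℝ) : ℂ) ^ k / (k.factorial : ℂ) * h k t)
    (fun θ => (-(lam : ℂ) * y) ^ (n + 1) / (n.factorial : ℂ) * (((1 - θ : ℝ) : ℂ) ^ n *
        ((Real.sign (x - θ * y) : ℝ) : ℂ) ^ (n + 1) * FpmDeriv ε (n + 1) (lam * |x - θ * y|)))
    (a := 0) (b := 1) (s := {x / y}) (Set.countable_singleton _) ?_ ?_ ?_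
  · rw [key]
    congr 1
    · simp [Finset.sum_range_succ', hdef, FpmAbsDeriv_zero]
    · refine Finset.sum_congr rfl fun k _ => ?_
      simp [hdef]
      ring
  · refine Continuous.continuousOn (continuous_finsetSum _ fun k hk => ?_)
    have hc := continuous_FpmAbsDeriv hε lam (k := k) (by have := Finset.mem_range.1 hk; omega)
    have : Continuous fun t : ℝ => FpmAbsDeriv ε lam k (x - t * y) := hc.comp (by fun_prop)
    fun_prop
  · rintro θ ⟨-, hθ⟩
    have hne : x - θ * y ≠ 0 := by
      intro h0
      exact hθ (Set.mem_singleton_iff.2 (by field_simp; linarith))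
    refine (hasDerivAt_taylor_sum h θ (hderiv θ hne) n).congr_deriv ?_
    simp only [hdef, FpmAbsDeriv_eq_sign_pow_mul ε lam (n + 1) hne]
    ring
  · exact (intervalIntegrable_remainder ε lam n (n + 1) x y).const_mul _

lemma integrable_pow_mul_of_weighted {α : ℕ} {g : ℝ → ℂ} (hgmeas : Measurable g)
    (hgint : Integrable (fun y : ℝ => (1 + |y|) ^ α * ‖g y‖)) {k : ℕ} (hk : k ≤ α) :
    Integrable fun y : ℝ => (y : ℂ) ^ k * g y := by
  refine hgint.mono' (by fun_prop) (Filter.Eventually.of_forall fun y => ?_)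
  rw [norm_mul, norm_pow, Complex.norm_real, Real.norm_eq_abs]
  gcongr
  calc |y| ^ k ≤ (1 + |y|) ^ k := by gcongr; linarith
    _ ≤ (1 + |y|) ^ α := pow_le_pow_right₀ (by linarith [abs_nonneg y]) hk

/-- Lemma 3.6: the action of the free resolvent kernel
`R₀^±(λ⁴)(x,y) = F_±(λ|x−y|)/(4λ³)` on a function `g` with vanishing moments up
to order `α − 1` gains `λ^α` powers:
`∫ R₀^±(λ⁴)(x,y) g(y) dy = ((−1)^α λ^{α−3}/(4(α−1)!)) ∫∫₀¹ (1−θ)^{α−1}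
(sgn(x−θy))^α F_±^{(α)}(λ|x−θy|) y^α g(y) dθ dy`. -/
theorem stmt_16 (α : ℕ) (hα : α ∈ ({1, 2, 3} : Set ℕ))
    (lam : ℝ) (hlam : 0 < lam) (ε : ℝ) (hε : ε = 1 ∨ ε = -1)
    (g : ℝ → ℂ) (hgmeas : Measurable g)
    (hgint : Integrable (fun y : ℝ => (1 + |y|)^α * ‖g y‖))
    (hmom : ∀ k : ℕ, k ≤ α - 1 → ∫ y : ℝ, (y : ℂ)^k * g y = 0)
    (x : ℝ) :
    ∫ y : ℝ, Fpm ε (lam * |x - y|) / (4 * (lam : ℂ)^3) * g y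
    = ((-1 : ℂ)^α * (lam : ℂ)^((α : ℤ) - 3) / (4 * (Nat.factorial (α - 1) : ℂ)))
      * ∫ y : ℝ, ∫ θ in (0:ℝ)..1,
          ((1 - θ : ℝ) : ℂ)^(α - 1) * ((Real.sign (x - θ * y) : ℝ) : ℂ)^α
          * iteratedDeriv α (Fpm ε) (lam * |x - θ * y|) * (y : ℂ)^α * g y := by
  obtain ⟨n, rfl, hn⟩ : ∃ n, α = n + 1 ∧ n < 3 := by
    rcases hα with rfl | rfl | rfl
    exacts [⟨0, rfl, by norm_num⟩, ⟨1, rfl, by norm_num⟩, ⟨2, rfl, by norm_num⟩]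
  have hl : (lam : ℂ) ≠ 0 := by exact_mod_cast hlam.ne'
  have hf : (n.factorial : ℂ) ≠ 0 := by exact_mod_cast n.factorial_ne_zero
  simp only [Nat.add_sub_cancel] at hmom ⊢
  have hpow := fun k (hk : k ≤ n + 1) => integrable_pow_mul_of_weighted hgmeas hgint hk
  have hg : Integrable g := by simpa using hpow 0 (Nat.zero_le _)
  have hFc : Continuous fun y : ℝ => Fpm ε (lam * |x - y|) := by
    unfold Fpm; fun_prop
  have hFg : Integrable fun y : ℝ => Fpm ε (lam * |x - y|) * g y := by
    refine hg.bdd_mul (c := 2) hFc.aestronglyMeasurable (Filter.Eventually.of_forall fun y => ?_)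
    have := norm_FpmDeriv_le hε 0 (mul_nonneg hlam.le (abs_nonneg (x - y)))
    simpa [FpmDeriv, Fpm] using this
  set c : ℕ → ℂ := fun k => (-(lam : ℂ)) ^ k / (k.factorial : ℂ) * FpmAbsDeriv ε lam k x with hc
  have hPi : ∀ k ∈ Finset.range (n + 1), Integrable fun y : ℝ => c k * ((y : ℂ) ^ k * g y) :=
    fun k hk => (hpow k (Finset.mem_range.1 hk).le).const_mul _
  have hP0 : ∫ y : ℝ, ∑ k ∈ Finset.range (n + 1), c k * ((y : ℂ) ^ k * g y) = 0 := by
    rw [integral_finsetSum _ hPi]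
    refine Finset.sum_eq_zero fun k hk => ?_
    rw [integral_const_mul, hmom k (Finset.mem_range_succ_iff.1 hk), mul_zero]
  have hLHS : ∫ y : ℝ, Fpm ε (lam * |x - y|) / (4 * (lam : ℂ) ^ 3) * g y =
      1 / (4 * (lam : ℂ) ^ 3) * ∫ y : ℝ, (Fpm ε (lam * |x - y|) * g y -
        ∑ k ∈ Finset.range (n + 1), c k * ((y : ℂ) ^ k * g y)) := by
    rw [integral_sub hFg (integrable_finsetSum _ hPi), hP0, sub_zero, ← integral_const_mul]
    congr 1 with y
    ring
  rw [hLHS, ← integral_const_mul, ← integral_const_mul]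
  congr 1 with y
  have hrem := integral_remainder hε lam hn x y
  have hsum : ∑ k ∈ Finset.range (n + 1), c k * ((y : ℂ) ^ k * g y) =
      (∑ k ∈ Finset.range (n + 1),
        (-(lam : ℂ) * y) ^ k / (k.factorial : ℂ) * FpmAbsDeriv ε lam k x) * g y := by
    rw [Finset.sum_mul]
    refine Finset.sum_congr rfl fun k _ => ?_
    simp only [hc]
    ring
  simp only [mul_assoc _ ((y : ℂ) ^ (n + 1)) (g y), intervalIntegral.integral_mul_const,
    iteratedDeriv_Fpm]
  rw [hsum, ← sub_mul, ← hrem, zpow_sub₀ hl, zpow_natCast]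
  have h3 : (lam : ℂ) ^ (3 : ℤ) = (lam : ℂ) ^ 3 := by norm_cast
  rw [h3, mul_pow, neg_pow (lam : ℂ)]
  ring
end
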